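/- Let Y₁,…,Y_N be independent random variables, each with the k-truncated Poisson distribution TPo_k(λ) where k is a fixed positive integer and 0 < λ ≤ log N, and let C = E[Y₁]. Then for any t ≥ √N (log N)², P(|Σ_{i=1}^N Y_i − CN| > t) = O(exp(−(t²/(8N))^{1/3})) as N → ∞. -/

import Mathlib

/-- `fk k x = ∑_{i ≥ k} x^i / i!`. -/
noncomputable def fk (k : ℕ) (x : ℝ) : ℝ :=
  ∑' i : ℕ, if k ≤ i then x ^ i / (Nat.factorial i : ℝ) else 0

open Finset in
/-- The exponential series with its factorials shifted by `k` grows no faster than `exp`. -/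
theorem tsum_pow_div_factorial_add_le (k : ℕ) {x v : ℝ} (hx : 0 ≤ x) (hv : 0 ≤ v) :
    ∑' j : ℕ, (x + x * v) ^ j / ((k + j).factorial : ℝ) ≤
      (∑' j : ℕ, x ^ j / ((k + j).factorial : ℝ)) * Real.exp (x * v) := by
  have hs : ∀ y : ℝ, 0 ≤ y → Summable fun j : ℕ => y ^ j / ((k + j).factorial : ℝ) :=
    fun y hy => (Real.summable_pow_div_factorial y).of_nonneg_of_le (fun j => by positivity)
      fun j => by gcongr; omega
  have hxv : 0 ≤ x * v := mul_nonneg hx hv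
  have hnn : ∀ y : ℝ, 0 ≤ y → ∀ j : ℕ, 0 ≤ y ^ j / ((k + j).factorial : ℝ) :=
    fun y hy j => by positivity
  have ha := (hs x hx).norm
  have hb := (Real.summable_pow_div_factorial (x * v)).norm
  rw [Real.exp_eq_exp_ℝ, NormedSpace.exp_eq_tsum_div,
    tsum_mul_tsum_eq_tsum_sum_antidiagonal_of_summable_norm ha hb]
  refine (hs _ (by positivity)).tsum_le_tsum (fun n => ?_)
    (summable_norm_sum_mul_antidiagonal_of_summable_norm ha hb).of_norm
  rw [(Commute.all x (x * v)).add_pow', sum_div]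
  refine sum_le_sum fun ij hij => ?_
  obtain ⟨i, j⟩ := ij
  obtain rfl : i + j = n := by simpa using hij
  have hc : (i + j).choose i * ((k + i).factorial * j.factorial) ≤ (k + (i + j)).factorial := by
    have h1 := Nat.choose_mul_factorial_mul_factorial (n := k + (i + j)) (k := j) (by omega)
    have h2 : k + (i + j) - j = k + i := by omega
    have h3 : (i + j).choose i ≤ (k + (i + j)).choose j := by
      rw [Nat.choose_symm_add]
      exact Nat.choose_le_choose _ (by omega)
    rw [h2] at h1
    calc _ ≤ (k + (i + j)).choose j * ((k + i).factorial * j.factorial) := by gcongr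
      _ = _ := by rw [← h1]; ring
  have hc' : ((i + j).choose i : ℝ) * ((k + i).factorial * j.factorial) ≤
      (k + (i + j)).factorial := by exact_mod_cast hc
  rw [nsmul_eq_mul, div_mul_div_comm, div_le_div_iff₀ (by positivity) (by positivity)]
  have : 0 ≤ x ^ i * (x * v) ^ j := by positivity
  simp only
  nlinarith [mul_le_mul_of_nonneg_left hc' this]

theorem summable_ite_pow_div_factorial (k : ℕ) {x : ℝ} (hx : 0 ≤ x) :
    Summable fun i : ℕ => if k ≤ i then x ^ i / (i.factorial : ℝ) else 0 :=
  (Real.summable_pow_div_factorial x).of_nonneg_of_le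
    (fun i => by split_ifs <;> positivity) fun i => by
      split_ifs
      · exact le_rfl
      · positivity

theorem fk_pos (k : ℕ) {x : ℝ} (hx : 0 < x) : 0 < fk k x :=
  (summable_ite_pow_div_factorial k hx.le).tsum_pos
    (fun i => by split_ifs <;> positivity) k (by simp only [le_refl, if_true]; positivity)

theorem fk_eq_pow_mul_tsum (k : ℕ) (x : ℝ) :
    fk k x = x ^ k * ∑' j : ℕ, x ^ j / ((k + j).factorial : ℝ) := by
  rw [fk, ← (add_right_injective k).tsum_eq, ← tsum_mul_left]
  · refine tsum_congr fun j => ?_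
    simp [pow_add, mul_div_assoc]
  · intro i hi
    have : k ≤ i := by
      by_contra h
      simp [h] at hi
    exact ⟨i - k, by simp only; omega⟩

theorem fk_mul_le (k : ℕ) {x u : ℝ} (hx : 0 ≤ x) (hu : 1 ≤ u) :
    fk k (x * u) ≤ u ^ k * Real.exp (x * (u - 1)) * fk k x := by
  have h := tsum_pow_div_factorial_add_le k hx (sub_nonneg.2 hu)
  rw [show x + x * (u - 1) = x * u by ring] at h
  rw [fk_eq_pow_mul_tsum, fk_eq_pow_mul_tsum, mul_pow]
  have : 0 ≤ x ^ k * u ^ k := by positivity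
  nlinarith [mul_le_mul_of_nonneg_left h this]

/-- The probability mass function of the `k`-truncated Poisson distribution. -/
noncomputable def truncPoisson (k : ℕ) (l : ℝ) (j : ℕ) : ℝ :=
  if k ≤ j then l ^ j / (fk k l * (Nat.factorial j : ℝ)) else 0

theorem truncPoisson_nonneg (k : ℕ) {l : ℝ} (hl : 0 < l) (j : ℕ) : 0 ≤ truncPoisson k l j := by
  have := fk_pos k hl
  unfold truncPoisson
  split_ifs <;> positivity

theorem hasSum_truncPoisson_mul_exp (k : ℕ) {l : ℝ} (hl : 0 < l) (a : ℝ) :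
    HasSum (fun j : ℕ => truncPoisson k l j * Real.exp (a * j))
      (fk k (l * Real.exp a) / fk k l) := by
  have h := (summable_ite_pow_div_factorial k
    (mul_pos hl (Real.exp_pos a)).le).hasSum.div_const (fk k l)
  refine h.congr_fun fun j => ?_
  unfold truncPoisson
  split_ifs
  · rw [mul_comm a, Real.exp_nat_mul, mul_pow, div_div]
    ring
  · simp

theorem hasSum_truncPoisson (k : ℕ) {l : ℝ} (hl : 0 < l) : HasSum (truncPoisson k l) 1 := by
  have h := hasSum_truncPoisson_mul_exp k hl 0
  simpa [div_self (fk_pos k hl).ne'] using h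

theorem tsum_truncPoisson_mul_exp_le (k : ℕ) {l R : ℝ} (hl : 0 < l) (hlR : l ≤ R) (hR : 1 ≤ R) :
    ∑' j : ℕ, truncPoisson k l j * Real.exp (R⁻¹ * j) ≤ Real.exp (k + 2) := by
  have hR0 : 0 < R := by linarith
  have hf := fk_pos k hl
  have hRi : R⁻¹ ≤ 1 := inv_le_one_of_one_le₀ hR
  have hRi0 : 0 < R⁻¹ := by positivity
  rw [(hasSum_truncPoisson_mul_exp k hl _).tsum_eq, div_le_iff₀ hf]
  refine (fk_mul_le k hl.le (Real.one_le_exp hRi0.le)).trans ?_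
  gcongr
  rw [← Real.exp_nat_mul, ← Real.exp_add]
  have h1 := Real.abs_exp_sub_one_le (x := R⁻¹) (by rwa [abs_of_pos hRi0])
  rw [abs_of_pos hRi0] at h1
  have h2 : l * (Real.exp R⁻¹ - 1) ≤ R * (2 * R⁻¹) :=
    mul_le_mul hlR (le_of_abs_le h1) (by linarith [Real.one_le_exp hRi0.le]) hR0.le
  have h3 : R * (2 * R⁻¹) = 2 := by field_simp
  have h4 : (k : ℝ) * R⁻¹ ≤ k := mul_le_of_le_one_right (by positivity) hRi
  gcongr
  linarith

theorem Real.exp_le_one_add_add_sq_mul_exp_abs (x : ℝ) :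
    Real.exp x ≤ 1 + x + x ^ 2 * Real.exp |x| := by
  have h := Complex.norm_exp_sub_sum_le_norm_mul_exp (x : ℂ) 2
  have e : Complex.exp (x : ℂ) - ∑ m ∈ Finset.range 2, (x : ℂ) ^ m / (m.factorial : ℂ) =
      ((Real.exp x - (1 + x) : ℝ) : ℂ) := by
    simp [Finset.sum_range_succ]
  rw [e, Complex.norm_real, Complex.norm_real, Real.norm_eq_abs, Real.norm_eq_abs, sq_abs] at h
  linarith [le_of_abs_le h]

/-- A quadratic bound for the centered moment generating function of a discrete distribution
with an exponential moment at `R⁻¹`. -/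
theorem tsum_mul_exp_centered_le {p : ℕ → ℝ} (hp : ∀ j, 0 ≤ p j) (hp1 : HasSum p 1)
    {R A : ℝ} (hR : 0 < R) (hs : Summable fun j : ℕ => p j * Real.exp (R⁻¹ * j))
    (hA : ∑' j : ℕ, p j * Real.exp (R⁻¹ * j) ≤ A) {θ : ℝ} (hθ : |θ| ≤ (2 * R)⁻¹) :
    (Summable fun j : ℕ => p j * Real.exp (θ * (j - ∑' j : ℕ, j * p j))) ∧
      ∑' j : ℕ, p j * Real.exp (θ * (j - ∑' j : ℕ, j * p j)) ≤
        Real.exp (8 * A * Real.exp A * R ^ 2 * θ ^ 2) := by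
  have hle : ∀ j : ℕ, (j : ℝ) * p j ≤ R * (p j * Real.exp (R⁻¹ * j)) := fun j => by
    have h1 : R⁻¹ * (j : ℝ) ≤ Real.exp (R⁻¹ * j) := by linarith [Real.add_one_le_exp (R⁻¹ * j)]
    have h2 : (j : ℝ) = R * (R⁻¹ * j) := by field_simp
    calc (j : ℝ) * p j = R * (p j * (R⁻¹ * j)) := by nth_rw 1 [h2]; ring
      _ ≤ _ := by have := hp j; gcongr
  have hms : Summable fun j : ℕ => (j : ℝ) * p j :=
    (hs.mul_left R).of_nonneg_of_le (fun j => mul_nonneg j.cast_nonneg (hp j)) hle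
  have hC0 : 0 ≤ ∑' j : ℕ, (j : ℝ) * p j := tsum_nonneg fun j => mul_nonneg j.cast_nonneg (hp j)
  have hCA : ∑' j : ℕ, (j : ℝ) * p j ≤ R * A :=
    (hms.tsum_le_tsum hle (hs.mul_left R)).trans
      (by rw [tsum_mul_left]; gcongr)
  have hmh := hms.hasSum
  set C := ∑' j : ℕ, (j : ℝ) * p j
  have hbound : ∀ j : ℕ, p j * Real.exp (θ * (j - C)) ≤ p j + θ * (j * p j - C * p j) +
      8 * R ^ 2 * θ ^ 2 * Real.exp A * (p j * Real.exp (R⁻¹ * j)) := fun j => by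
    have h1 := Real.exp_le_one_add_add_sq_mul_exp_abs (θ * (j - C))
    have hz0 : 0 ≤ R⁻¹ * |(j : ℝ) - C| := by positivity
    have h2 : |θ * (j - C)| ≤ R⁻¹ * |(j : ℝ) - C| / 2 := by
      rw [abs_mul]
      calc |θ| * |(j : ℝ) - C| ≤ (2 * R)⁻¹ * |(j : ℝ) - C| := by gcongr
        _ = _ := by rw [mul_inv]; ring
    have h3 : R⁻¹ * |(j : ℝ) - C| ≤ R⁻¹ * j + A := by
      have : |(j : ℝ) - C| ≤ j + R * A := by
        rw [abs_le]; constructor <;> linarith [(j.cast_nonneg : (0 : ℝ) ≤ j)]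
      calc R⁻¹ * |(j : ℝ) - C| ≤ R⁻¹ * (j + R * A) := by gcongr
        _ = _ := by field_simp
    have h4 := Real.quadratic_le_exp_of_nonneg (div_nonneg hz0 zero_le_two)
    have h5 : (θ * (j - C)) ^ 2 = θ ^ 2 * R ^ 2 * (R⁻¹ * |(j : ℝ) - C|) ^ 2 := by
      rw [mul_pow _ |_|, sq_abs]; field_simp
    set z := R⁻¹ * |(j : ℝ) - C|
    have h6 : z ^ 2 ≤ 8 * Real.exp (z / 2) := by nlinarith
    have h7 : (θ * (j - C)) ^ 2 * Real.exp |θ * (j - C)| ≤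
        θ ^ 2 * R ^ 2 * (8 * (Real.exp (R⁻¹ * j) * Real.exp A)) := by
      calc _ ≤ θ ^ 2 * R ^ 2 * (8 * Real.exp (z / 2)) * Real.exp (z / 2) := by
            rw [h5]; gcongr
        _ = θ ^ 2 * R ^ 2 * (8 * Real.exp z) := by
            rw [show Real.exp z = Real.exp (z / 2) * Real.exp (z / 2) by
              rw [← Real.exp_add]; ring_nf]
            ring
        _ ≤ _ := by rw [← Real.exp_add]; gcongr
    calc p j * Real.exp (θ * (j - C))
        ≤ p j * (1 + θ * (j - C) +
            θ ^ 2 * R ^ 2 * (8 * (Real.exp (R⁻¹ * j) * Real.exp A))) := by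
          have := hp j
          gcongr
          linarith
      _ = _ := by ring
  have hh := (hp1.add ((hmh.sub (hp1.mul_left C)).mul_left θ)).add
    (hs.hasSum.mul_left (8 * R ^ 2 * θ ^ 2 * Real.exp A))
  have hsum : Summable fun j : ℕ => p j * Real.exp (θ * (j - C)) :=
    hh.summable.of_nonneg_of_le (fun j => mul_nonneg (hp j) (Real.exp_pos _).le) hbound
  refine ⟨hsum, (hsum.tsum_le_tsum hbound hh.summable).trans ?_⟩
  rw [hh.tsum_eq]
  have h8 : 8 * R ^ 2 * θ ^ 2 * Real.exp A * ∑' j : ℕ, p j * Real.exp (R⁻¹ * j) ≤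
      8 * R ^ 2 * θ ^ 2 * Real.exp A * A := by gcongr
  have := Real.add_one_le_exp (8 * A * Real.exp A * R ^ 2 * θ ^ 2)
  nlinarith

theorem hasSum_pi_prod {α : Type*} {f : α → ℝ} {s : ℝ} (hf : ∀ a, 0 ≤ f a) (h : HasSum f s)
    (n : ℕ) : HasSum (fun y : Fin n → α => ∏ i, f (y i)) (s ^ n) := by
  induction n with
  | zero => simp
  | succ n ih =>
    rw [← (Fin.consEquiv fun _ => α).hasSum_iff, pow_succ']
    have hsm := h.summable.mul_of_nonneg ih.summable hf fun y => Finset.prod_nonneg fun i _ => hf _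
    refine (h.mul ih hsm).congr_fun fun x => ?_
    simp [Fin.consEquiv, Fin.prod_univ_succ]

open Classical in
/-- A two-sided Chernoff bound for sums of independent discrete variables. -/
theorem tsum_ite_lt_abs_le {p : ℕ → ℝ} (hp : ∀ j, 0 ≤ p j) {C θ M : ℝ} (hθ : 0 ≤ θ)
    (h₁ : Summable fun j : ℕ => p j * Real.exp (θ * (j - C)))
    (hM₁ : ∑' j : ℕ, p j * Real.exp (θ * (j - C)) ≤ M)
    (h₂ : Summable fun j : ℕ => p j * Real.exp (-θ * (j - C)))
    (hM₂ : ∑' j : ℕ, p j * Real.exp (-θ * (j - C)) ≤ M) (N : ℕ) (t : ℝ) :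
    (∑' y : Fin N → ℕ, if t < |(∑ i, (y i : ℝ)) - C * N| then ∏ i, p (y i) else 0) ≤
      2 * M ^ N * Real.exp (-(θ * t)) := by
  have hnn : ∀ θ : ℝ, ∀ j : ℕ, 0 ≤ p j * Real.exp (θ * (j - C)) :=
    fun θ j => mul_nonneg (hp j) (Real.exp_pos _).le
  have hprod : ∀ (θ : ℝ) (y : Fin N → ℕ), ∏ i, p (y i) * Real.exp (θ * (y i - C)) =
      (∏ i, p (y i)) * Real.exp (θ * ((∑ i, (y i : ℝ)) - C * N)) := fun θ y => by
    rw [Finset.prod_mul_distrib, ← Real.exp_sum, ← Finset.mul_sum, Finset.sum_sub_distrib]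
    simp [mul_comm]
  have hh := ((hasSum_pi_prod (hnn θ) h₁.hasSum N).add
    (hasSum_pi_prod (hnn (-θ)) h₂.hasSum N)).mul_right (Real.exp (-(θ * t)))
  have hP : ∀ y : Fin N → ℕ, 0 ≤ ∏ i, p (y i) := fun y => Finset.prod_nonneg fun i _ => hp _
  have hle : ∀ y : Fin N → ℕ,
      (if t < |(∑ i, (y i : ℝ)) - C * N| then ∏ i, p (y i) else 0) ≤
        (∏ i, p (y i) * Real.exp (θ * (y i - C)) + ∏ i, p (y i) * Real.exp (-θ * (y i - C))) *
          Real.exp (-(θ * t)) := fun y => by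
    rw [hprod, hprod, ← mul_add, mul_assoc]
    have h0 := hP y
    split_ifs with hy
    · refine le_mul_of_one_le_right h0 ?_
      have h3 : 1 ≤ Real.exp (θ * |(∑ i, (y i : ℝ)) - C * N|) * Real.exp (-(θ * t)) := by
        rw [← Real.exp_add]
        exact Real.one_le_exp (by nlinarith)
      refine h3.trans ?_
      gcongr
      rcases abs_choice ((∑ i, (y i : ℝ)) - C * N) with h | h <;> rw [h]
      · linarith [Real.exp_pos (-θ * ((∑ i, (y i : ℝ)) - C * N))]
      · rw [mul_neg, ← neg_mul]
        linarith [Real.exp_pos (θ * ((∑ i, (y i : ℝ)) - C * N))]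
    · positivity
  have hs := hh.summable.of_nonneg_of_le
    (fun y => by split_ifs; exacts [hP y, le_rfl]) hle
  refine (hs.tsum_le_tsum hle hh.summable).trans ?_
  rw [hh.tsum_eq]
  have h4 := pow_le_pow_left₀ (tsum_nonneg (hnn θ)) hM₁ N
  have h5 := pow_le_pow_left₀ (tsum_nonneg (hnn (-θ))) hM₂ N
  gcongr
  linarith

/-- Optimizing the sub-exponential Chernoff exponent at scale `2 * L`. -/
theorem exists_chernoff_parameter {D L N t : ℝ} (hD : 32 ≤ D) (hL : 0 < L) (hLN : L ≤ N)
    (ht : Real.sqrt N * L ^ 2 ≤ t) :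
    ∃ θ : ℝ, 0 ≤ θ ∧ θ ≤ (2 * (2 * L))⁻¹ ∧
      N * (D * (2 * L) ^ 2 * θ ^ 2) - θ * t ≤
        32 * D ^ 2 - (t ^ 2 / (8 * N)) ^ ((1 : ℝ) / 3) := by
  have hN : 0 < N := hL.trans_le hLN
  have ht0 : 0 < t := lt_of_lt_of_le (by positivity) ht
  have hD0 : 0 < D := by linarith
  set Δ := (t ^ 2 / (8 * N)) ^ ((1 : ℝ) / 3) with hΔ
  have hΔ0 : 0 < Δ := by positivity
  have hΔ3 : Δ ^ 3 = t ^ 2 / (8 * N) := by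
    rw [hΔ, ← Real.rpow_natCast, ← Real.rpow_mul (by positivity)]
    norm_num
  have ht2 : t ^ 2 = 8 * N * Δ ^ 3 := by rw [hΔ3]; field_simp
  have hL4 : L ^ 4 ≤ 8 * Δ ^ 3 := by
    have h := pow_le_pow_left₀ (by positivity) ht 2
    rw [mul_pow, Real.sq_sqrt hN.le, ht2] at h
    refine le_of_mul_le_mul_left ?_ hN
    linarith
  by_cases hc : t ≤ 2 * N * D * L
  · by_cases hd : Δ ^ 2 ≤ 2 * D * L ^ 2
    · refine ⟨0, le_rfl, by positivity, ?_⟩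
      have h1 : L ^ 8 ≤ 512 * D ^ 3 * L ^ 6 := by
        calc L ^ 8 = (L ^ 4) ^ 2 := by ring
          _ ≤ (8 * Δ ^ 3) ^ 2 := by gcongr
          _ = 64 * (Δ ^ 2) ^ 3 := by ring
          _ ≤ 64 * (2 * D * L ^ 2) ^ 3 := by gcongr
          _ = _ := by ring
      have h2 : L ^ 2 ≤ 512 * D ^ 3 := by
        refine le_of_mul_le_mul_right ?_ (pow_pos hL 6)
        linarith
      have h3 : Δ ≤ 32 * D ^ 2 := by
        refine le_of_sq_le_sq ?_ (by positivity)
        calc Δ ^ 2 ≤ 2 * D * L ^ 2 := hd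
          _ ≤ 2 * D * (512 * D ^ 3) := by gcongr
          _ = _ := by ring
      simpa using h3
    · push Not at hd
      refine ⟨t / (8 * N * D * L ^ 2), by positivity, ?_, ?_⟩
      · rw [div_le_iff₀ (by positivity)]
        calc t ≤ 2 * N * D * L := hc
          _ = _ := by field_simp; norm_num
      · have h1 : N * (D * (2 * L) ^ 2 * (t / (8 * N * D * L ^ 2)) ^ 2) -
            t / (8 * N * D * L ^ 2) * t = -(t ^ 2 / (16 * N * D * L ^ 2)) := by
          field_simp; ring
        have h2 : Δ ≤ t ^ 2 / (16 * N * D * L ^ 2) := by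
          rw [le_div_iff₀ (by positivity), ht2]
          nlinarith [mul_le_mul_of_nonneg_left hd.le (by positivity : 0 ≤ 8 * N * Δ)]
        rw [h1]
        have : 0 ≤ 32 * D ^ 2 := by positivity
        linarith
  · push Not at hc
    refine ⟨(2 * (2 * L))⁻¹, by positivity, le_rfl, ?_⟩
    have h1 : N * (D * (2 * L) ^ 2 * ((2 * (2 * L))⁻¹) ^ 2) = N * D / 4 := by
      field_simp; norm_num
    have h2 : (2 * (2 * L))⁻¹ * t = t / (8 * L) + t / (8 * L) := by field_simp; norm_num
    have h3 : N * D / 4 ≤ t / (8 * L) := by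
      rw [le_div_iff₀ (by positivity)]; linarith
    have h4 : 64 * L ^ 3 ≤ N * t := by
      calc 64 * L ^ 3 = L * L * (2 * 32 * L) := by ring
        _ ≤ N * N * (2 * D * L) := by gcongr
        _ = N * (2 * N * D * L) := by ring
        _ ≤ N * t := by gcongr
    have h5 : Δ ≤ t / (8 * L) := by
      refine le_of_pow_le_pow_left₀ (n := 3) (by norm_num) (by positivity) ?_
      rw [hΔ3, div_pow, div_le_div_iff₀ (by positivity) (by positivity)]
      nlinarith [mul_le_mul_of_nonneg_left h4 (by positivity : 0 ≤ 8 * t ^ 2)]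
    have : 0 ≤ 32 * D ^ 2 := by positivity
    rw [h1, h2]
    linarith

open Classical in
/-- Let `Y₁, …, Y_N` be independent `TPo_k(λ)` random variables, `k ≥ 1` fixed,
`0 < λ ≤ log N`, and `C = E[Y₁]`.  Then for any `t ≥ √N (log N)²`,
`P(|∑ Y_i - C N| > t) = O(exp(-(t²/(8N))^{1/3}))` as `N → ∞`. -/
theorem stmt_18 (k : ℕ) (hk : 1 ≤ k) :
    ∃ C₀ : ℝ, 0 < C₀ ∧ ∀ (N : ℕ) (l t : ℝ), 0 < l → l ≤ Real.log N →
      Real.sqrt N * (Real.log N) ^ 2 ≤ t →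
      (∑' y : Fin N → ℕ,
        if t < |(∑ i, (y i : ℝ)) -
            (∑' j : ℕ, (j : ℝ) *
              (if k ≤ j then l ^ j / (fk k l * (Nat.factorial j : ℝ)) else 0)) * N| then
          ∏ i, (if k ≤ y i then l ^ (y i) / (fk k l * (Nat.factorial (y i) : ℝ)) else 0)
        else 0)
      ≤ C₀ * Real.exp (-(t ^ 2 / (8 * N)) ^ ((1 : ℝ) / 3)) := by
  have hA : (1 : ℝ) ≤ Real.exp (k + 2) := Real.one_le_exp (by positivity)
  set A := Real.exp ((k : ℝ) + 2)
  have hAA : 1 ≤ A * Real.exp A := one_le_mul_of_one_le_of_one_le hA (Real.one_le_exp (by linarith))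
  set D := 32 * (A * Real.exp A)
  refine ⟨2 * Real.exp (32 * D ^ 2), by positivity, fun N l t hl hlN ht => ?_⟩
  have hL : 0 < Real.log N := hl.trans_le hlN
  have hN : 1 < (N : ℝ) := (Real.log_pos_iff N.cast_nonneg).1 hL
  have hN2 : (2 : ℝ) ≤ N := by exact_mod_cast (show 2 ≤ N by exact_mod_cast hN)
  have hLN : Real.log N ≤ N := Real.log_le_self N.cast_nonneg
  have hR : 1 ≤ 2 * Real.log N := by
    linarith [Real.log_le_log two_pos hN2, Real.log_two_gt_d9]
  obtain ⟨θ, hθ0, hθ, hexp⟩ := exists_chernoff_parameter (D := D) (by linarith) hL hLN ht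
  have hp := truncPoisson_nonneg k hl
  have hmgf : ∀ φ : ℝ, |φ| ≤ (2 * (2 * Real.log N))⁻¹ → _ := fun φ hφ =>
    tsum_mul_exp_centered_le hp (hasSum_truncPoisson k hl) (by linarith)
      (hasSum_truncPoisson_mul_exp k hl _).summable
      (tsum_truncPoisson_mul_exp_le k hl (by linarith) hR) hφ
  have h₁ := hmgf θ (by rwa [abs_of_nonneg hθ0])
  have h₂ := hmgf (-θ) (by rwa [abs_neg, abs_of_nonneg hθ0])
  rw [neg_sq] at h₂
  refine (tsum_ite_lt_abs_le hp hθ0 h₁.1 h₁.2 h₂.1 h₂.2 N t).trans ?_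
  rw [← Real.exp_nat_mul, mul_assoc 2, mul_assoc 2, ← Real.exp_add, ← Real.exp_add]
  refine mul_le_mul_of_nonneg_left (Real.exp_le_exp.2 ?_) zero_le_two
  have hmono : N * (8 * A * Real.exp A * (2 * Real.log N) ^ 2 * θ ^ 2) ≤
      N * (D * (2 * Real.log N) ^ 2 * θ ^ 2) := by
    gcongr
    linarith
  linarith
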